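/- For integers 1 ≤ k ≤ n, the following polynomial identity holds in ℤ[x]: Σ_{I ⊆ {1,…,k}} binom(n, ΔI) · x^{|I|} = Σ_{D ∈ nc(k−1)} E(n,D) · x^{|D|} · (1+x)^{k−2|D|}. (Both sides equal the augmented Chow polynomial of the uniform matroid U_{k,n}.) -/

import Mathlib

open Finset Polynomial

/-- Differences list: `diffList N prev [m₁,…,m_s] = [m₁ - prev, m₂ - m₁, …, N - m_s]`. -/
def diffList (N : ℕ) : ℕ → List ℕ → List ℕ
  | prev, [] => [N - prev]
  | prev, m :: ms => (m - prev) :: diffList N m ms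

/-- The minima of the maximal blocks of consecutive integers of `I`, listed increasingly. -/
def blockMinima (I : Finset ℕ) : List ℕ :=
  (I.filter fun i => i - 1 ∉ I).sort (· ≤ ·)

/-- The multinomial coefficient `binom(n, ΔI)`:
for `I` with block minima `m₁ < … < m_s` this is
`n! / ((m₁-1)! (m₂-m₁)! ⋯ (m_s-m_{s-1})! (n-m_s+1)!)`, and `1` for `I = ∅`. -/
def binomDelta (n : ℕ) (I : Finset ℕ) : ℕ :=
  n.factorial / ((diffList (n + 1) 1 (blockMinima I)).map Nat.factorial).prod

/-- One-line notation: `oneline n w i = w(i)` for `i ∈ {1,…,n}`, with values in `{1,…,n}`. -/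
def oneline (n : ℕ) (w : Equiv.Perm (Fin n)) (i : ℕ) : ℕ :=
  if h : i - 1 < n then (w ⟨i - 1, h⟩ : ℕ) + 1 else 0

/-- The descent set `Des(w) ⊆ {1,…,n-1}` of a permutation `w` of `{1,…,n}`:
positions `i` with `w(i) > w(i+1)`. -/
def descSet (n : ℕ) (w : Equiv.Perm (Fin n)) : Finset ℕ :=
  (Finset.Ico 1 n).filter fun i => oneline n w (i + 1) < oneline n w i

/-- `E(n, D)`: the number of permutations of `{1,…,n}` with descent set exactly `D`. -/
def eulerianCount (n : ℕ) (D : Finset ℕ) : ℕ :=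
  (Finset.univ.filter fun w : Equiv.Perm (Fin n) => descSet n w = D).card

/-- Raising the threshold from `i` to `i + 1` changes the count by the membership of `i + 1`. -/
theorem countP_le_succ {L : List ℕ} (hL : L.Nodup) (i : ℕ) :
    L.countP (· ≤ i + 1) = L.countP (· ≤ i) + if i + 1 ∈ L then 1 else 0 := by
  induction L with
  | nil => simp
  | cons m ms ih =>
    rw [List.nodup_cons] at hL
    have := ih hL.2
    simp only [List.countP_cons, List.mem_cons, decide_eq_true_eq]
    rcases lt_trichotomy m (i + 1) with h | h | h
    · simp [this, h.le, Nat.lt_succ_iff.mp h, h.ne']; omega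
    · subst h
      simp [this, hL.1]
    · simp [this, h.ne, h.not_ge, show ¬ m ≤ i by omega]

theorem prod_factorial_diffList (N : ℕ) (L : List ℕ) (prev : ℕ)
    (hL : L.Pairwise (· < ·)) (h1 : ∀ m ∈ L, prev ≤ m) (h2 : ∀ m ∈ L, m ≤ N) :
    ((diffList N prev L).map Nat.factorial).prod =
      ∏ j ∈ range (L.length + 1), (#{i ∈ Ico prev N | L.countP (· ≤ i) = j}).factorial := by
  induction L generalizing prev with
  | nil => simp [diffList]
  | cons m ms ih =>
    rw [List.pairwise_cons] at hL
    have hm1 := h1 m (by simp)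
    have hm2 := h2 m (by simp)
    have hzero : ∀ i < m, ms.countP (· ≤ i) = 0 := fun i hi => by
      rw [List.countP_eq_zero]
      intro a ha
      have := hL.1 a ha
      simp; omega
    rw [diffList, List.map_cons, List.prod_cons, List.length_cons, prod_range_succ', mul_comm,
      ih m hL.2 (fun a ha => (hL.1 a ha).le) (fun a ha => h2 a (by simp [ha]))]
    congr 1
    · refine prod_congr rfl fun j _ => ?_
      congr 2
      ext i
      simp only [mem_filter, mem_Ico, List.countP_cons, decide_eq_true_eq]
      by_cases hi : m ≤ i
      · simp [hi]; omega
      · simp [hi, hzero i (by omega)]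
    · rw [← Nat.card_Ico]
      congr 2
      ext i
      simp only [mem_filter, mem_Ico, List.countP_cons, decide_eq_true_eq]
      by_cases hi : m ≤ i
      · simp [hi]
      · simp [hi, hzero i (by omega)]; omega

/-- Every permutation can be sorted blockwise in exactly one way, where the blocks are the fibers
of a monotone function `b`. -/
theorem card_blockwise_monotone_mul {n : ℕ} {β : Type*} [LinearOrder β] (b : Fin n → β)
    (hb : Monotone b) :
    Fintype.card {w : Equiv.Perm (Fin n) // Monotone fun i => toLex (b i, w i)} *
      Fintype.card {g : Equiv.Perm (Fin n) // b ∘ g = b} = n.factorial := by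
  rw [← Fintype.card_prod]
  conv_rhs => rw [← Fintype.card_fin n, ← Fintype.card_perm]
  refine Fintype.card_of_bijective
    (f := fun p : {w : Equiv.Perm (Fin n) // Monotone fun i => toLex (b i, w i)} ×
      {g : Equiv.Perm (Fin n) // b ∘ g = b} => p.1.1 * p.2.1⁻¹) ⟨?_, ?_⟩
  · rintro ⟨⟨w, hw⟩, ⟨g, hg⟩⟩ ⟨⟨w', hw'⟩, ⟨g', hg'⟩⟩ h
    simp only at h
    have hw1 : w = (w * g⁻¹) * g := by group
    have hw2 : w' = (w * g⁻¹) * g' := by rw [h]; group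
    set σ := w * g⁻¹
    have e1 : (fun i => toLex (b i, w i)) = (fun i => toLex (b i, σ i)) ∘ g := by
      funext i
      have := congrFun hg i
      simp only [Function.comp_apply] at this
      simp [this, hw1]
    have e2 : (fun i => toLex (b i, w' i)) = (fun i => toLex (b i, σ i)) ∘ g' := by
      funext i
      have := congrFun hg' i
      simp only [Function.comp_apply] at this
      simp [this, hw2]
    have e := Tuple.unique_monotone (e1 ▸ hw) (e2 ▸ hw')
    have hgg : g = g' := by
      ext1 i
      have := congrFun e i
      simp only [Function.comp_apply, EmbeddingLike.apply_eq_iff_eq, Prod.mk.injEq] at this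
      exact this.2
    subst hgg
    have : w = w' := hw1.trans hw2.symm
    subst this
    rfl
  · intro σ
    set g := Tuple.sort fun i => toLex (b i, σ i)
    have hmono : Monotone ((fun i => toLex (b i, σ i)) ∘ g) := Tuple.monotone_sort _
    have hbg : b ∘ g = b := by
      refine Tuple.unique_monotone (f := b) (σ := g) (τ := 1) ?_ (by simpa using hb)
      intro i j hij
      have := hmono hij
      simp only [Function.comp_apply, Prod.Lex.toLex_le_toLex] at this ⊢
      rcases this with h | h
      · exact h.le
      · exact h.1.le
    refine ⟨⟨⟨σ * g, ?_⟩, ⟨g, hbg⟩⟩, by simp⟩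
    convert hmono using 1
    funext i
    have := congrFun hbg i
    simp only [Function.comp_apply] at this
    simp [this]

theorem monotone_toLex_countP_iff {n : ℕ} {L : List ℕ} (hL : L.Nodup)
    (w : Equiv.Perm (Fin n)) :
    (Monotone fun i : Fin n => toLex (L.countP (· ≤ (i : ℕ) + 1), w i)) ↔
      ∀ d ∈ descSet n w, d + 1 ∈ L := by
  rcases n with _ | n
  · exact ⟨fun _ d hd => by simp [descSet] at hd, fun _ i => i.elim0⟩
  rw [Fin.monotone_iff_le_succ]
  have key : ∀ i : Fin n,
      (toLex (L.countP (· ≤ (i.castSucc : ℕ) + 1), w i.castSucc) ≤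
        toLex (L.countP (· ≤ (i.succ : ℕ) + 1), w i.succ)) ↔
      (w i.succ < w i.castSucc → (i : ℕ) + 1 + 1 ∈ L) := by
    intro i
    rw [Prod.Lex.toLex_le_toLex]
    simp only [Fin.val_castSucc, Fin.val_succ, countP_le_succ hL ((i : ℕ) + 1)]
    by_cases h : (i : ℕ) + 1 + 1 ∈ L <;> simp [h]
  refine (forall_congr' key).trans ⟨fun h d hd => ?_, fun h i hi => ?_⟩
  · rw [descSet, mem_filter, mem_Ico] at hd
    obtain ⟨⟨hd1, hd2⟩, hd3⟩ := hd
    obtain ⟨e, rfl⟩ : ∃ e, d = e + 1 := ⟨d - 1, by omega⟩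
    refine h ⟨e, by omega⟩ ?_
    simp only [oneline, Nat.add_sub_cancel, hd2, show e < n + 1 by omega, dif_pos] at hd3
    rw [Fin.lt_def]
    exact Nat.lt_of_succ_lt_succ hd3
  · refine h _ ?_
    rw [descSet, mem_filter, mem_Ico]
    refine ⟨⟨by omega, by omega⟩, ?_⟩
    simp only [oneline, Nat.add_sub_cancel, show (i : ℕ) + 1 < n + 1 by omega,
      show (i : ℕ) < n + 1 by omega, dif_pos]
    exact Nat.succ_lt_succ hi

theorem card_descSet_mul {n : ℕ} {L : List ℕ} (hL : L.Pairwise (· < ·))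
    (h1 : ∀ m ∈ L, 1 ≤ m) (h2 : ∀ m ∈ L, m ≤ n + 1) :
    #{w : Equiv.Perm (Fin n) | ∀ d ∈ descSet n w, d + 1 ∈ L} *
      ((diffList (n + 1) 1 L).map Nat.factorial).prod = n.factorial := by
  let b : Fin n → Fin (L.length + 1) := fun i =>
    ⟨L.countP (· ≤ (i : ℕ) + 1), Nat.lt_succ_of_le List.countP_le_length⟩
  have hb : Monotone b := fun i j hij => by
    refine Fin.mk_le_mk.mpr (List.countP_mono_left fun a _ ha => ?_)
    simp only [decide_eq_true_eq] at ha ⊢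
    have := Fin.le_def.mp hij
    omega
  rw [← card_blockwise_monotone_mul b hb, DomMulAct.stabilizer_card,
    prod_factorial_diffList (n + 1) L 1 hL h1 h2,
    ← Fin.prod_univ_eq_prod_range
      (fun j => (#{i ∈ Ico 1 (n + 1) | L.countP (· ≤ i) = j}).factorial)]
  congr 1
  · rw [Fintype.card_subtype]
    congr 1
    ext w
    simp only [mem_filter, mem_univ, true_and]
    rw [← monotone_toLex_countP_iff (hL.imp ne_of_lt)]
    refine forall₃_congr fun i j _ => ?_
    simp only [Prod.Lex.toLex_le_toLex, b, Fin.lt_def, Fin.ext_iff]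
  · refine prod_congr rfl fun j _ => ?_
    rw [Fintype.card_subtype]
    congr 1
    symm
    refine card_bij (fun i _ => (i : ℕ) + 1) (fun i hi => ?_) (fun i _ j _ h => ?_)
      fun i hi => ?_
    · simp only [mem_filter, mem_univ, true_and, b, Fin.ext_iff] at hi
      simp only [mem_filter, mem_Ico]
      exact ⟨⟨by omega, by omega⟩, hi⟩
    · exact Fin.ext (by omega)
    · simp only [mem_filter, mem_Ico] at hi
      obtain ⟨e, rfl⟩ : ∃ e, i = e + 1 := ⟨i - 1, by omega⟩
      exact ⟨⟨e, by omega⟩, by simpa [b, Fin.ext_iff] using hi.2, rfl⟩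

theorem binomDelta_eq_card {n : ℕ} {I : Finset ℕ} (hI : I ⊆ Icc 1 (n + 1)) :
    binomDelta n I =
      #{w : Equiv.Perm (Fin n) | ∀ d ∈ descSet n w, d + 1 ∈ I ∧ d ∉ I} := by
  have hmem : ∀ m, m ∈ blockMinima I ↔ m ∈ I ∧ m - 1 ∉ I := by simp [blockMinima]
  have hb : ∀ m ∈ blockMinima I, 1 ≤ m ∧ m ≤ n + 1 := fun m hm =>
    mem_Icc.mp (hI ((hmem m).mp hm).1)
  have h := card_descSet_mul (n := n) (L := blockMinima I) (sortedLT_sort _).pairwise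
    (fun m hm => (hb m hm).1) (fun m hm => (hb m hm).2)
  simp only [hmem, Nat.add_sub_cancel] at h
  refine Nat.div_eq_of_eq_mul_left (Nat.pos_of_ne_zero fun h0 => ?_) h.symm
  rw [h0, mul_zero] at h
  exact n.factorial_ne_zero h.symm

theorem binomDelta_eq_sum {n k : ℕ} (hkn : k ≤ n) {I : Finset ℕ} (hI : I ⊆ Icc 1 k) :
    binomDelta n I =
      ∑ D ∈ (Icc 1 (k - 1)).powerset with ∀ d ∈ D, d + 1 ∈ I ∧ d ∉ I, eulerianCount n D := by
  rw [binomDelta_eq_card (hI.trans (Icc_subset_Icc le_rfl (by omega))),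
    card_eq_sum_card_fiberwise (f := descSet n)
      (t := {D ∈ (Icc 1 (k - 1)).powerset | ∀ d ∈ D, d + 1 ∈ I ∧ d ∉ I})]
  · refine sum_congr rfl fun D hD => ?_
    rw [eulerianCount, filter_filter]
    congr 1
    ext w
    simp only [mem_filter, mem_univ, true_and, and_iff_right_iff_imp]
    rintro rfl
    exact (mem_filter.mp hD).2
  · intro w hw
    simp only [coe_filter, mem_univ, true_and, Set.mem_ofPred_eq, mem_powerset] at hw ⊢
    refine ⟨fun d hd => ?_, hw⟩
    have h1 := (mem_Icc.mp (hI (hw d hd).1)).2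
    have h2 := (mem_Ico.mp (mem_filter.mp hd).1).1
    exact mem_Icc.mpr ⟨h2, by omega⟩

theorem sum_X_pow_card_of_descents {R : Type*} [CommSemiring R] {k : ℕ} (hk : 1 ≤ k)
    {D : Finset ℕ} (hD : D ⊆ Icc 1 (k - 1)) (hnc : ∀ i ∈ D, i + 1 ∉ D) :
    ∑ I ∈ (Icc 1 k).powerset with ∀ d ∈ D, d + 1 ∈ I ∧ d ∉ I, (X : Polynomial R) ^ #I =
      X ^ #D * (1 + X) ^ (k - 2 * #D) := by
  set D' := D.image (· + 1) with hD'
  have hcD' : #D' = #D := card_image_of_injective _ (add_left_injective 1)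
  have hdisj : Disjoint D D' := by
    rw [disjoint_left]
    intro a ha ha'
    obtain ⟨d, hd, rfl⟩ := mem_image.mp ha'
    exact hnc d hd ha
  have hDk : D ⊆ Icc 1 k := hD.trans (Icc_subset_Icc le_rfl (by omega))
  have hD'k : D' ⊆ Icc 1 k := fun a ha => by
    obtain ⟨d, hd, rfl⟩ := mem_image.mp ha
    have := mem_Icc.mp (hD hd)
    exact mem_Icc.mpr ⟨by omega, by omega⟩
  have hcR : #(Icc 1 k \ (D ∪ D')) = k - 2 * #D := by
    rw [card_sdiff_of_subset (union_subset hDk hD'k), card_union_of_disjoint hdisj, hcD',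
      Nat.card_Icc]
    omega
  rw [← hcR, ← prod_const (1 + X), prod_one_add, mul_sum]
  symm
  refine sum_bij' (fun J _ => D' ∪ J) (fun I _ => I \ D') ?_ ?_ ?_ ?_ ?_
  · intro J hJ
    rw [mem_powerset] at hJ
    refine mem_filter.mpr ⟨mem_powerset.mpr (union_subset hD'k (hJ.trans sdiff_subset)),
      fun d hd => ⟨mem_union_left _ (mem_image_of_mem _ hd), fun h => ?_⟩⟩
    rcases mem_union.mp h with h | h
    · exact disjoint_left.mp hdisj hd h
    · exact (mem_sdiff.mp (hJ h)).2 (mem_union_left _ hd)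
  · intro I hI
    obtain ⟨hI, hID⟩ := mem_filter.mp hI
    rw [mem_powerset] at hI ⊢
    intro a ha
    obtain ⟨ha, ha'⟩ := mem_sdiff.mp ha
    refine mem_sdiff.mpr ⟨hI ha, fun h => ?_⟩
    rcases mem_union.mp h with h | h
    · exact (hID a h).2 ha
    · exact ha' h
  · intro J hJ
    rw [mem_powerset] at hJ
    refine union_sdiff_cancel_left (disjoint_left.mpr fun a ha ha' => ?_)
    exact (mem_sdiff.mp (hJ ha')).2 (mem_union_right _ ha)
  · intro I hI
    refine union_sdiff_of_subset fun a ha => ?_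
    obtain ⟨d, hd, rfl⟩ := mem_image.mp ha
    exact ((mem_filter.mp hI).2 d hd).1
  · intro J hJ
    rw [mem_powerset] at hJ
    rw [prod_const, card_union_of_disjoint, pow_add, hcD']
    exact disjoint_left.mpr fun a ha ha' =>
      (mem_sdiff.mp (hJ ha')).2 (mem_union_right _ ha)

/-- For `1 ≤ k ≤ n`, in `ℤ[x]`:
`Σ_{I ⊆ {1,…,k}} binom(n, ΔI) x^{|I|}
  = Σ_{D ∈ nc(k-1)} E(n,D) x^{|D|} (1+x)^{k-2|D|}`. -/
theorem augChow_uniform_monomial_eq_gamma_eulerian (n k : ℕ) (hk : 1 ≤ k) (hkn : k ≤ n) :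
    ∑ I ∈ (Finset.Icc 1 k).powerset,
      (binomDelta n I : Polynomial ℤ) * X ^ I.card
    = ∑ D ∈ (Finset.Icc 1 (k - 1)).powerset.filter (fun D => ∀ i ∈ D, i + 1 ∉ D),
      (eulerianCount n D : Polynomial ℤ) * X ^ D.card
        * (1 + X) ^ (k - 2 * D.card) := by
  have hstep : ∀ I ∈ (Icc 1 k).powerset,
      (binomDelta n I : Polynomial ℤ) * X ^ #I =
        ∑ D ∈ (Icc 1 (k - 1)).powerset, if ∀ d ∈ D, d + 1 ∈ I ∧ d ∉ I then
          (eulerianCount n D : Polynomial ℤ) * X ^ #I else 0 := fun I hI => by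
    rw [binomDelta_eq_sum hkn (mem_powerset.mp hI), Nat.cast_sum, sum_mul, sum_filter]
  rw [sum_congr rfl hstep, sum_comm, sum_filter]
  refine sum_congr rfl fun D hD => ?_
  rw [← sum_filter, ← mul_sum]
  split_ifs with hnc
  · rw [sum_X_pow_card_of_descents hk (mem_powerset.mp hD) hnc, mul_assoc]
  · push Not at hnc
    obtain ⟨i, hi, hi'⟩ := hnc
    rw [filter_false_of_mem fun I _ h => (h (i + 1) hi').2 (h i hi).1, sum_empty, mul_zero]
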